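/- Let {c_n}_{n≥1} be a real sequence and {d_{n+1}}_{n≥1} a positive chain sequence, and let R_n be the complex polynomials defined by R_{−1} ≡ 0, R_0 ≡ 1 and R_{n+1}(z) = [(1+ic_{n+1})z + (1−ic_{n+1})] R_n(z) − 4 d_{n+1} z R_{n−1}(z) for n ≥ 0. Then for every n ≥ 1 the polynomial R_n has n simple zeros, all lying on the unit circle and distinct from 1, which can be written as z_{n,j} = e^{iθ_{n,j}} with 0 < θ_{n,1} < θ_{n,2} < ⋯ < θ_{n,n} < 2π; moreover the zeros of R_n and R_{n+1} strictly interlace: 0 < θ_{n+1,1} < θ_{n,1} < θ_{n+1,2} < ⋯ < θ_{n,n} < θ_{n+1,n+1} < 2π. -/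

import Mathlib

noncomputable section

/-- `{d_{n+1}}_{n≥1}` is a positive chain sequence: there is a parameter sequence `g` with
`0 ≤ g_1 < 1`, `0 < g_n < 1` for `n ≥ 2`, and `d_{n+1} = (1 - g_n) g_{n+1}` for `n ≥ 1`. -/
def IsPositiveChainSeq (d : ℕ → ℝ) : Prop :=
  ∃ g : ℕ → ℝ, (0 ≤ g 1 ∧ g 1 < 1) ∧ (∀ n, 2 ≤ n → 0 < g n ∧ g n < 1) ∧
    ∀ n, 1 ≤ n → d (n + 1) = (1 - g n) * g (n + 1)

/-- The para-orthogonal polynomials `R_n`: `R_0 = 1` and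
`R_{n+1}(z) = [(1+ic_{n+1})z + (1-ic_{n+1})] R_n(z) - 4 d_{n+1} z R_{n-1}(z)` with `R_{-1} = 0`. -/
def Rpoly (c d : ℕ → ℝ) : ℕ → Polynomial ℂ
  | 0 => 1
  | 1 => Polynomial.C (1 + Complex.I * ((c 1 : ℝ) : ℂ)) * Polynomial.X +
      Polynomial.C (1 - Complex.I * ((c 1 : ℝ) : ℂ))
  | n + 2 =>
      (Polynomial.C (1 + Complex.I * ((c (n + 2) : ℝ) : ℂ)) * Polynomial.X +
        Polynomial.C (1 - Complex.I * ((c (n + 2) : ℝ) : ℂ))) * Rpoly c d (n + 1) -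
      Polynomial.C ((4 * d (n + 2) : ℝ) : ℂ) * Polynomial.X * Rpoly c d n

/-- The real trigonometric function with `R_n(e^{2ix}) = 2^n e^{inx} W_n(x)`. -/
def trigW (c d : ℕ → ℝ) : ℕ → ℝ → ℝ
  | 0, _ => 1
  | 1, x => Real.cos x - c 1 * Real.sin x
  | n + 2, x => (Real.cos x - c (n + 2) * Real.sin x) * trigW c d (n + 1) x -
      d (n + 2) * trigW c d n x

theorem continuous_trigW (c d : ℕ → ℝ) (n : ℕ) : Continuous (trigW c d n) := by
  induction n using Nat.twoStepInduction with
  | zero => exact continuous_const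
  | one =>
    change Continuous fun x => Real.cos x - c 1 * Real.sin x
    fun_prop
  | more n h₁ h₂ =>
    change Continuous fun x => (Real.cos x - c (n + 2) * Real.sin x) * trigW c d (n + 1) x -
      d (n + 2) * trigW c d n x
    fun_prop

theorem one_add_mul_exp_add (a x : ℝ) :
    (1 + Complex.I * (a : ℂ)) * Complex.exp (Complex.I * ((2 * x : ℝ) : ℂ)) +
        (1 - Complex.I * (a : ℂ)) =
      2 * Complex.exp (Complex.I * x) * ((Real.cos x - a * Real.sin x : ℝ) : ℂ) := by
  have h : Complex.exp (Complex.I * ((2 * x : ℝ) : ℂ)) = Complex.exp (Complex.I * x) ^ 2 := by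
    rw [← Complex.exp_nat_mul]; congr 1; push_cast; ring
  have e : Complex.exp (Complex.I * x) = Complex.cos x + Complex.sin x * Complex.I := by
    rw [mul_comm, Complex.exp_mul_I]
  rw [h, e]
  push_cast
  linear_combination (Complex.sin x ^ 2 * (1 + Complex.I * a) +
    2 * a * Complex.cos x * Complex.sin x) * Complex.I_sq -
    (1 - Complex.I * a) * Complex.sin_sq_add_cos_sq x

theorem eval_Rpoly (c d : ℕ → ℝ) (n : ℕ) (x : ℝ) :
    (Rpoly c d n).eval (Complex.exp (Complex.I * ((2 * x : ℝ) : ℂ))) =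
      2 ^ n * Complex.exp (Complex.I * x) ^ n * (trigW c d n x : ℂ) := by
  have h : Complex.exp (Complex.I * ((2 * x : ℝ) : ℂ)) = Complex.exp (Complex.I * x) ^ 2 := by
    rw [← Complex.exp_nat_mul]; congr 1; push_cast; ring
  induction n using Nat.twoStepInduction with
  | zero => simp [Rpoly, trigW]
  | one =>
    have := one_add_mul_exp_add (c 1) x
    simp only [Rpoly, trigW, Polynomial.eval_add, Polynomial.eval_mul, Polynomial.eval_C,
      Polynomial.eval_X, pow_one]
    exact this
  | more n h₁ h₂ =>
    have := one_add_mul_exp_add (c (n + 2)) x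
    simp only [Rpoly, trigW, Polynomial.eval_add, Polynomial.eval_mul, Polynomial.eval_C,
      Polynomial.eval_X, Polynomial.eval_sub]
    rw [this, h₁, h₂, h]
    push_cast
    ring

theorem trigW_eq_zero_iff (c d : ℕ → ℝ) (n : ℕ) (x : ℝ) :
    trigW c d n x = 0 ↔
      (Rpoly c d n).eval (Complex.exp (Complex.I * ((2 * x : ℝ) : ℂ))) = 0 := by
  rw [eval_Rpoly]
  simp [Complex.exp_ne_zero]

theorem natDegree_Rpoly_le (c d : ℕ → ℝ) (n : ℕ) : (Rpoly c d n).natDegree ≤ n := by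
  induction n using Nat.twoStepInduction with
  | zero => simp [Rpoly]
  | one => unfold Rpoly; compute_degree
  | more n h₁ h₂ =>
    unfold Rpoly
    refine (Polynomial.natDegree_sub_le _ _).trans (max_le ?_ ?_)
    · refine (Polynomial.natDegree_mul_le_of_le (m := 1) (n := n + 1) ?_ h₂).trans (by omega)
      compute_degree
    · refine (Polynomial.natDegree_mul_le_of_le (m := 1) (n := n) ?_ h₁).trans (by omega)
      compute_degree

theorem IsPositiveChainSeq.pos {d : ℕ → ℝ} (hd : IsPositiveChainSeq d) (n : ℕ) :
    0 < d (n + 2) := by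
  obtain ⟨g, ⟨-, h1⟩, hg, hdg⟩ := hd
  rw [hdg (n + 1) (by omega)]
  refine mul_pos (sub_pos.2 ?_) (hg (n + 2) (by omega)).1
  rcases Nat.eq_zero_or_pos n with rfl | h
  · exact h1
  · exact (hg (n + 1) (by omega)).2

/-- Solutions of `a_{n+2} = a_{n+1} - d_{n+2} a_n`, `a_0 = a_1 = 1`, are positive. -/
theorem IsPositiveChainSeq.recurrence_pos {d : ℕ → ℝ} (hd : IsPositiveChainSeq d) {a : ℕ → ℝ}
    (h0 : a 0 = 1) (h1 : a 1 = 1) (h : ∀ n, a (n + 2) = a (n + 1) - d (n + 2) * a n) (n : ℕ) :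
    0 < a n := by
  obtain ⟨g, ⟨hg0, hg1⟩, hg, hdg⟩ := hd
  suffices 0 < a n ∧ (1 - g (n + 1)) * a n ≤ a (n + 1) from this.1
  induction n with
  | zero => simp [h0, h1, hg0]
  | succ n ih =>
    have hlt : g (n + 1) < 1 := by
      rcases Nat.eq_zero_or_pos n with rfl | h
      · exact hg1
      · exact (hg (n + 1) (by omega)).2
    refine ⟨(mul_pos (sub_pos.2 hlt) ih.1).trans_le ih.2, ?_⟩
    rw [h n, hdg (n + 1) (by omega)]
    have := mul_le_mul_of_nonneg_left ih.2 (hg (n + 2) (by omega)).1.le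
    simp only [add_assoc, Nat.reduceAdd] at this ⊢
    linarith

theorem trigW_zero_pos (c : ℕ → ℝ) {d : ℕ → ℝ} (hd : IsPositiveChainSeq d) (n : ℕ) :
    0 < trigW c d n 0 :=
  hd.recurrence_pos (a := fun n => trigW c d n 0) (by simp [trigW]) (by simp [trigW])
    (fun n => by simp [trigW]) n

theorem trigW_pi_pos (c : ℕ → ℝ) {d : ℕ → ℝ} (hd : IsPositiveChainSeq d) (n : ℕ) :
    0 < (-1) ^ n * trigW c d n Real.pi :=
  hd.recurrence_pos (a := fun n => (-1) ^ n * trigW c d n Real.pi) (by simp [trigW])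
    (by simp [trigW]) (fun n => by simp [trigW]; ring) n

theorem Rpoly_ne_zero (c : ℕ → ℝ) {d : ℕ → ℝ} (hd : IsPositiveChainSeq d) (n : ℕ) :
    Rpoly c d n ≠ 0 := by
  intro h
  refine (trigW_zero_pos c hd n).ne' ?_
  rw [trigW_eq_zero_iff, h, Polynomial.eval_zero]

theorem exp_I_mul_two_mul_injOn :
    Set.InjOn (fun x : ℝ => Complex.exp (Complex.I * ((2 * x : ℝ) : ℂ)))
      (Set.Ioo 0 Real.pi) := by
  intro x hx y hy hxy
  obtain ⟨k, hk⟩ := Complex.exp_eq_exp_iff_exists_int.1 hxy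
  have h : x = y + k * Real.pi := by
    have : Complex.I * ((x : ℂ) - (y + k * Real.pi)) = 0 := by
      push_cast at hk; linear_combination hk / 2
    have := (mul_eq_zero.1 this).resolve_left Complex.I_ne_zero
    exact_mod_cast sub_eq_zero.1 this
  have hpi := Real.pi_pos
  have h₁ : k < 1 := by
    by_contra! hc
    have : (1 : ℝ) ≤ k := by exact_mod_cast hc
    nlinarith [hx.2, hy.1]
  have h₂ : -1 < k := by
    by_contra! hc
    have : (k : ℝ) ≤ -1 := by exact_mod_cast hc
    nlinarith [hx.1, hy.2]
  obtain rfl : k = 0 := by omega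
  simpa using h

theorem roots_Rpoly_eq (c : ℕ → ℝ) {d : ℕ → ℝ} (hd : IsPositiveChainSeq d) (n : ℕ) (s : ℕ → ℝ)
    (hinj : Set.InjOn s (Set.Iio n)) (hs : ∀ j < n, s j ∈ Set.Ioo 0 Real.pi)
    (h0 : ∀ j < n, trigW c d n (s j) = 0) :
    (Rpoly c d n).roots =
      (Multiset.range n).map fun j => Complex.exp (Complex.I * ((2 * s j : ℝ) : ℂ)) := by
  symm
  apply Multiset.eq_of_le_of_card_le
  · rw [Multiset.le_iff_subset]
    · intro z hz
      obtain ⟨j, hj, rfl⟩ := Multiset.mem_map.1 hz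
      rw [Multiset.mem_range] at hj
      rw [Polynomial.mem_roots (Rpoly_ne_zero c hd n), Polynomial.IsRoot, ← trigW_eq_zero_iff]
      exact h0 j hj
    · refine Multiset.Nodup.map_on ?_ (Multiset.nodup_range n)
      intro i hi j hj hij
      rw [Multiset.mem_range] at hi hj
      exact hinj hi hj (exp_I_mul_two_mul_injOn (hs i hi) (hs j hj) hij)
  · simpa using (Polynomial.card_roots' _).trans (natDegree_Rpoly_le c d n)

/-- `t 1 < ⋯ < t n` are zeros of `trigW c d n` in `(0, π)`, padded by `t 0 = 0` and
`t (n + 1) = π`; between them `trigW c d n` alternates in sign, and so does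
`trigW c d (n - 1)` at them. -/
structure IsTrigZeros (c d : ℕ → ℝ) (n : ℕ) (t : ℕ → ℝ) : Prop where
  zero : t 0 = 0
  last : t (n + 1) = Real.pi
  lt : ∀ i j, i < j → j ≤ n + 1 → t i < t j
  eq_zero : ∀ j < n, trigW c d n (t (j + 1)) = 0
  sign : ∀ j ≤ n, ∀ x ∈ Set.Ioo (t j) (t (j + 1)), 0 < (-1) ^ j * trigW c d n x
  sign_pred : ∀ j < n, 0 < (-1) ^ j * trigW c d (n - 1) (t (j + 1))

theorem IsTrigZeros.mem_Ioo {c d : ℕ → ℝ} {n : ℕ} {t : ℕ → ℝ} (h : IsTrigZeros c d n t) {j : ℕ}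
    (hj : j < n) : t (j + 1) ∈ Set.Ioo 0 Real.pi := by
  rw [← h.zero, ← h.last]
  exact ⟨h.lt _ _ (by omega) (by omega), h.lt _ _ (by omega) (by omega)⟩

theorem isTrigZeros_zero (c d : ℕ → ℝ) :
    IsTrigZeros c d 0 (fun j => if j = 0 then 0 else Real.pi) where
  zero := by simp
  last := by simp
  lt i j hij hj := by
    obtain rfl : i = 0 := by omega
    obtain rfl : j = 1 := by omega
    simpa using Real.pi_pos
  eq_zero j hj := by omega
  sign j hj x hx := by
    obtain rfl : j = 0 := by omega
    simp [trigW]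
  sign_pred j hj := by omega

theorem lt_of_forall_lt_succ {s : ℕ → ℝ} {N : ℕ} (h : ∀ j < N, s j < s (j + 1)) (i j : ℕ)
    (hij : i < j) (hj : j ≤ N) : s i < s j := by
  induction j, hij using Nat.le_induction with
  | base => exact h i (by omega)
  | succ k hk ih => exact (ih (by omega)).trans (h k (by omega))

/-- `trigW c d (n + 1)` alternates in sign along the zeros of `trigW c d n` and the endpoints. -/
theorem IsTrigZeros.sign_succ {c d : ℕ → ℝ} (hd : IsPositiveChainSeq d) {n : ℕ} {t : ℕ → ℝ}
    (h : IsTrigZeros c d n t) (j : ℕ) (hj : j ≤ n + 1) :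
    0 < (-1) ^ j * trigW c d (n + 1) (t j) := by
  rcases Nat.eq_zero_or_pos j with rfl | hj0
  · simpa [h.zero] using trigW_zero_pos c hd (n + 1)
  rcases hj.lt_or_eq with hlt | rfl
  · obtain ⟨k, rfl⟩ := Nat.exists_eq_add_of_le' hj0
    obtain ⟨m, rfl⟩ : ∃ m, n = m + 1 := ⟨n - 1, by omega⟩
    have h₁ := h.sign_pred k (by omega)
    have h₂ := h.eq_zero k (by omega)
    have h₃ := mul_pos (hd.pos m) h₁
    simp only [Nat.add_sub_cancel] at h₃
    rw [trigW, h₂, pow_succ]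
    linarith
  · rw [h.last]
    exact trigW_pi_pos c hd (n + 1)

theorem IsTrigZeros.exists_succ {c d : ℕ → ℝ} (hd : IsPositiveChainSeq d) {n : ℕ} {t : ℕ → ℝ}
    (h : IsTrigZeros c d n t) :
    ∃ s, IsTrigZeros c d (n + 1) s ∧ ∀ j < n, s (j + 1) < t (j + 1) ∧ t (j + 1) < s (j + 2) := by
  have key : ∀ j, ∃ x, j ≤ n → (t j < x ∧ x < t (j + 1)) ∧ trigW c d (n + 1) x = 0 := by
    intro j
    by_cases hj : j ≤ n
    · have h₁ := h.sign_succ hd j (by omega)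
      have h₂ := h.sign_succ hd (j + 1) (by omega)
      have hc : Continuous fun x => (-1) ^ j * trigW c d (n + 1) x :=
        continuous_const.mul (continuous_trigW c d (n + 1))
      obtain ⟨x, hx, hx0⟩ := intermediate_value_Ioo' (h.lt j (j + 1) (by omega) (by omega)).le
        hc.continuousOn (show (0 : ℝ) ∈ Set.Ioo _ _ from ⟨by rw [pow_succ] at h₂; linarith, h₁⟩)
      exact ⟨x, fun _ => ⟨hx, by simpa using hx0⟩⟩
    · exact ⟨0, fun h => absurd h hj⟩
  choose x hx using key
  set s : ℕ → ℝ := fun j => if j = 0 then 0 else if j ≤ n + 1 then x (j - 1) else Real.pi with hs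
  have s0 : s 0 = 0 := by simp [hs]
  have sx : ∀ j ≤ n, s (j + 1) = x j := fun j hj => by simp [hs, hj]
  have slast : s (n + 2) = Real.pi := by simp [hs]
  have hts : ∀ j ≤ n, t j < s (j + 1) := fun j hj => by rw [sx j hj]; exact (hx j hj).1.1
  have hst : ∀ j ≤ n, s (j + 1) < t (j + 1) := fun j hj => by rw [sx j hj]; exact (hx j hj).1.2
  have hst' : ∀ j ≤ n + 1, s j ≤ t j := by
    rintro (_ | j) hj
    · rw [s0, h.zero]
    · exact (hst j (by omega)).le
  have hts' : ∀ j ≤ n + 1, t j ≤ s (j + 1) := by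
    intro j hj
    rcases hj.lt_or_eq with hlt | rfl
    · exact (hts j (by omega)).le
    · rw [h.last, slast]
  have hlt : ∀ i j, i < j → j ≤ n + 2 → s i < s j := by
    refine lt_of_forall_lt_succ fun j hj => ?_
    rcases (Nat.lt_succ_iff.1 hj).lt_or_eq with hj' | rfl
    · exact (hst' j (by omega)).trans_lt (hts j (by omega))
    · exact (hst n le_rfl).trans_le (hts' _ le_rfl)
  have hmem : ∀ j < n + 1, s (j + 1) ∈ Set.Ioo 0 Real.pi := fun j hj => by
    rw [← s0, ← slast]
    exact ⟨hlt _ _ (by omega) (by omega), hlt _ _ (by omega) (by omega)⟩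
  have hzero : ∀ j < n + 1, trigW c d (n + 1) (s (j + 1)) = 0 := fun j hj => by
    rw [sx j (by omega)]; exact (hx j (by omega)).2
  have hinj : Set.InjOn (fun j => s (j + 1)) (Set.Iio (n + 1)) := by
    intro i hi j hj hij
    simp only [Set.mem_Iio] at hi hj hij
    rcases lt_trichotomy i j with h' | h' | h'
    · exact absurd hij (hlt _ _ (by omega) (by omega)).ne
    · exact h'
    · exact absurd hij (hlt _ _ (by omega) (by omega)).ne'
  have hroots := roots_Rpoly_eq c hd (n + 1) (fun j => s (j + 1)) hinj hmem hzero
  have hne : ∀ j ≤ n + 1, ∀ y ∈ Set.Ioo (s j) (s (j + 1)), trigW c d (n + 1) y ≠ 0 := by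
    intro j hj y hy hy0
    have hy' : y ∈ Set.Ioo 0 Real.pi := by
      constructor
      · rcases Nat.eq_zero_or_pos j with rfl | hj0
        · rw [← s0]; exact hy.1
        · rw [← s0]; exact (hlt 0 j hj0 (by omega)).trans hy.1
      · rw [← slast]
        rcases hj.lt_or_eq with hlt' | rfl
        · exact hy.2.trans (hlt _ _ (by omega) le_rfl)
        · exact hy.2
    rw [trigW_eq_zero_iff, ← Polynomial.IsRoot,
      ← Polynomial.mem_roots (Rpoly_ne_zero c hd (n + 1)), hroots] at hy0
    obtain ⟨k, hk, hky⟩ := Multiset.mem_map.1 hy0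
    rw [Multiset.mem_range] at hk
    have hky' : s (k + 1) = y := exp_I_mul_two_mul_injOn (hmem k hk) hy' hky
    rw [← hky'] at hy
    rcases lt_or_ge k j with hkj | hkj
    · rcases (Nat.succ_le_of_lt hkj).lt_or_eq with h' | h'
      · exact lt_asymm hy.1 (hlt _ _ h' (by omega))
      · rw [← h'] at hy
        exact lt_irrefl _ hy.1
    · rcases hkj.lt_or_eq with h' | rfl
      · exact lt_asymm hy.2 (hlt _ _ (by omega) (by omega))
      · exact lt_irrefl _ hy.2
  refine ⟨s, ⟨s0, slast, hlt, hzero, ?_, ?_⟩, fun j hj =>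
    ⟨hst j (by omega), hts (j + 1) (by omega)⟩⟩
  · intro j hj y hy
    by_contra! hneg
    have hpos := h.sign_succ hd j hj
    have hc : Continuous fun x => (-1) ^ j * trigW c d (n + 1) x :=
      continuous_const.mul (continuous_trigW c d (n + 1))
    obtain ⟨z, hz, hz0⟩ := intermediate_value_uIcc (a := y) (b := t j) hc.continuousOn
      (show (0 : ℝ) ∈ _ from Set.mem_uIcc.2 (Or.inl ⟨hneg, hpos.le⟩))
    have hz0' : trigW c d (n + 1) z = 0 := by simpa using hz0
    have hzt : z ≠ t j := by
      rintro rfl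
      simp [hz0'] at hpos
    refine hne j hj z ?_ hz0'
    have a₁ := hst' j hj
    have a₂ := hts' j hj
    rcases Set.mem_uIcc.1 hz with ⟨b₁, b₂⟩ | ⟨b₁, b₂⟩
    · exact ⟨hy.1.trans_le b₁, (lt_of_le_of_ne b₂ hzt).trans_le a₂⟩
    · exact ⟨a₁.trans_lt (lt_of_le_of_ne b₁ hzt.symm), b₂.trans_lt hy.2⟩
  · intro j hj
    exact h.sign j (by omega) _ ⟨hts j (by omega), hst j (by omega)⟩

theorem stmt18 (c d : ℕ → ℝ) (hd : IsPositiveChainSeq d) :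
    ∃ θ : ℕ → ℕ → ℝ,
      (∀ n, 1 ≤ n →
        (∀ j, 1 ≤ j → j ≤ n → 0 < θ n j ∧ θ n j < 2 * Real.pi) ∧
        (∀ j k, 1 ≤ j → j < k → k ≤ n → θ n j < θ n k) ∧
        (Rpoly c d n).roots =
          (Multiset.range n).map fun j => Complex.exp (Complex.I * ((θ n (j + 1) : ℝ) : ℂ))) ∧
      (∀ n, 1 ≤ n → ∀ j, 1 ≤ j → j ≤ n →
        θ (n + 1) j < θ n j ∧ θ n j < θ (n + 1) (j + 1)) := by
  choose f hf hfi using fun (n : ℕ) (p : {t // IsTrigZeros c d n t}) => p.2.exists_succ hd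
  let F : ∀ n, {t // IsTrigZeros c d n t} := fun n =>
    Nat.rec ⟨_, isTrigZeros_zero c d⟩ (fun n p => ⟨f n p, hf n p⟩) n
  have hF : ∀ n, (F (n + 1)).1 = f n (F n) := fun _ => rfl
  refine ⟨fun n j => 2 * (F n).1 j, fun n _ => ⟨fun j h1 hj => ?_, fun j k h1 hjk hk => ?_, ?_⟩,
    fun n _ j h1 hj => ?_⟩
  · obtain ⟨i, rfl⟩ := Nat.exists_eq_add_of_le' h1
    have := (F n).2.mem_Ioo (j := i) (by omega)
    exact ⟨by linarith [this.1], by linarith [this.2]⟩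
  · linarith [(F n).2.lt j k hjk (by omega)]
  · refine roots_Rpoly_eq c hd n (fun j => (F n).1 (j + 1)) ?_
      (fun j hj => (F n).2.mem_Ioo hj) (F n).2.eq_zero
    intro i hi j hj hij
    simp only [Set.mem_Iio] at hi hj hij
    rcases lt_trichotomy i j with h | h | h
    · exact absurd hij ((F n).2.lt _ _ (by omega) (by omega)).ne
    · exact h
    · exact absurd hij ((F n).2.lt _ _ (by omega) (by omega)).ne'
  · obtain ⟨i, rfl⟩ := Nat.exists_eq_add_of_le' h1
    have := hfi n (F n) i (by omega)
    simp only [hF]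
    exact ⟨by linarith [this.1], by linarith [this.2]⟩
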